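/- Borel's theorem: for every m, n ∈ ℕ and every map t : ℕ^m → ℝ^n there exists a smooth function ψ : ℝ^m → ℝ^n such that for every multi-index I ∈ ℕ^m, the Taylor coefficient of ψ at 0 equals t, i.e. ∂^I ψ(0) / I! = t(I). -/

import Mathlib

noncomputable section

/-- Directional (partial) derivative of a map on `Fin m → ℝ` in the `i`-th coordinate
direction. -/
def dirDeriv {m : ℕ} {F : Type} [NormedAddCommGroup F] [NormedSpace ℝ F]
    (i : Fin m) (f : (Fin m → ℝ) → F) : (Fin m → ℝ) → F :=
  fun x => fderiv ℝ f x (Pi.single i 1)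

/-- Iterated partial derivative along a list of coordinate directions. -/
def iterDeriv {m : ℕ} {F : Type} [NormedAddCommGroup F] [NormedSpace ℝ F]
    (L : List (Fin m)) (f : (Fin m → ℝ) → F) : (Fin m → ℝ) → F :=
  L.foldr (fun i g => dirDeriv i g) f

/-- The list of coordinate directions encoding a multi-index `I ∈ ℕ^m`:
the direction `j` is repeated `I j` times. -/
def multiIdxList (m : ℕ) (I : Fin m → ℕ) : List (Fin m) :=
  (List.finRange m).flatMap fun j => List.replicate (I j) j

open Filter Topology in
theorem borel_iterDeriv_eq {m : ℕ} {F : Type} [NormedAddCommGroup F] [NormedSpace ℝ F]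
    (f : (Fin m → ℝ) → F) (hf : ContDiff ℝ (⊤ : ℕ∞) f) (L : List (Fin m)) (x : Fin m → ℝ) :
    iterDeriv L f x =
      iteratedFDeriv ℝ L.length f x (fun i => Pi.single (L.get i) 1) := by
  induction L generalizing x with
  | nil => simp [iterDeriv]
  | cons a L ih =>
    have h1 : iterDeriv (a :: L) f x = fderiv ℝ (iterDeriv L f) x (Pi.single a 1) := rfl
    rw [h1, funext ih]
    have hd : DifferentiableAt ℝ (iteratedFDeriv ℝ L.length f) x :=
      (hf.differentiable_iteratedFDeriv (by exact_mod_cast ENat.coe_lt_top _)) x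
    rw [fderiv_continuousMultilinear_apply_const_apply hd]
    rfl

/-- The monomial `x ^ J`. -/
def borelMono {m : ℕ} (J : Fin m → ℕ) (x : Fin m → ℝ) : ℝ := ∏ j, x j ^ J j

theorem borelMono_contDiff {m : ℕ} (J : Fin m → ℕ) : ContDiff ℝ (⊤ : ℕ∞) (borelMono J) := by
  unfold borelMono
  fun_prop

theorem borelMono_smul {m : ℕ} (J : Fin m → ℕ) (a : ℝ) (x : Fin m → ℝ) :
    borelMono J (a • x) = a ^ (∑ j, J j) * borelMono J x := by
  simp [borelMono, mul_pow, Finset.prod_mul_distrib, Finset.prod_pow_eq_pow_sum]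

theorem borelMono_fderiv {m : ℕ} (J : Fin m → ℕ) (i : Fin m) (x : Fin m → ℝ) :
    fderiv ℝ (borelMono J) x (Pi.single i 1) =
      J i * borelMono (fun j => J j - if i = j then 1 else 0) x := by
  have h := HasFDerivAt.finsetProd (𝕜 := ℝ) (u := Finset.univ) (x := x)
    (g := fun (j : Fin m) (y : Fin m → ℝ) => y j ^ J j)
    (g' := fun j => (J j * x j ^ (J j - 1)) • ContinuousLinearMap.proj (R := ℝ) j)
    (fun j _ => by
      simpa using (hasFDerivAt_apply (𝕜 := ℝ) j x).pow (J j))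
  have h2 : fderiv ℝ (borelMono J) x = _ := h.fderiv
  rw [h2, sum_apply, Finset.sum_eq_single i]
  · unfold borelMono
    rw [← Finset.mul_prod_erase Finset.univ _ (Finset.mem_univ i)]
    have : ∏ j ∈ Finset.univ.erase i, x j ^ (J j - if i = j then 1 else 0) =
        ∏ j ∈ Finset.univ.erase i, x j ^ J j := by
      refine Finset.prod_congr rfl fun j hj => ?_
      rw [if_neg (Finset.ne_of_mem_erase hj).symm, Nat.sub_zero]
    rw [this]
    simp
    ring
  · intro j _ hj
    simp [hj]
  · simp

theorem borelMono_iterDeriv {m : ℕ} {F : Type} [NormedAddCommGroup F] [NormedSpace ℝ F]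
    (J : Fin m → ℕ) (c : F) (L : List (Fin m)) (x : Fin m → ℝ) :
    iterDeriv L (fun x => borelMono J x • c) x =
      (((∏ j, (J j).descFactorial (L.count j) : ℕ) : ℝ) *
        borelMono (fun j => J j - L.count j) x) • c := by
  induction L generalizing x with
  | nil => simp [iterDeriv]
  | cons a L ih =>
    have h1 : iterDeriv (a :: L) (fun x => borelMono J x • c) x =
      fderiv ℝ (iterDeriv L (fun x => borelMono J x • c)) x (Pi.single a 1) := rfl
    have hd : DifferentiableAt ℝ (borelMono (fun j => J j - L.count j)) x :=
      (borelMono_contDiff _).differentiable (by simp) x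
    rw [h1, funext ih, fderiv_smul_const (hd.const_mul _), fderiv_const_mul hd]
    simp only [ContinuousLinearMap.smulRight_apply, ContinuousLinearMap.smul_apply,
      borelMono_fderiv]
    congr 1
    have e1 : (fun j => J j - List.count j L - if a = j then 1 else 0) =
        fun j => J j - List.count j (a :: L) := by
      funext j
      rw [List.count_cons]
      by_cases h : a = j <;> simp [h, Nat.sub_sub]
    have e2 : ∏ j, (J j).descFactorial ((a :: L).count j) =
        (J a - L.count a) * ∏ j, (J j).descFactorial (L.count j) := by
      rw [← Finset.mul_prod_erase Finset.univ _ (Finset.mem_univ a),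
        ← Finset.mul_prod_erase Finset.univ (fun j => (J j).descFactorial (L.count j))
          (Finset.mem_univ a)]
      have : ∏ j ∈ Finset.univ.erase a, (J j).descFactorial ((a :: L).count j) =
          ∏ j ∈ Finset.univ.erase a, (J j).descFactorial (L.count j) := by
        refine Finset.prod_congr rfl fun j hj => ?_
        rw [List.count_cons_of_ne (Finset.ne_of_mem_erase hj).symm]
      rw [this, List.count_cons_self, Nat.descFactorial_succ, mul_assoc]
    rw [e1, e2]
    push_cast
    simp only [smul_eq_mul]
    ring

theorem borel_count {m : ℕ} (I : Fin m → ℕ) (j : Fin m) :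
    (multiIdxList m I).count j = I j := by
  unfold multiIdxList
  rw [List.count_flatMap]
  simp only [Function.comp_def, List.count_replicate]
  rw [← List.ofFn_eq_map, List.sum_ofFn]
  simp

theorem borelMono_coeff {m : ℕ} {F : Type} [NormedAddCommGroup F] [NormedSpace ℝ F]
    (I J : Fin m → ℕ) (c : F) :
    iterDeriv (multiIdxList m I) (fun x => borelMono J x • c) 0 =
      if J = I then ((∏ j, Nat.factorial (I j) : ℕ) : ℝ) • c else 0 := by
  rw [borelMono_iterDeriv]
  simp only [borel_count]
  split_ifs with h
  · subst h
    simp [borelMono, Nat.descFactorial_self]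
  · obtain ⟨j, hj⟩ := Function.ne_iff.1 h
    rcases lt_or_gt_of_ne hj with h1 | h1
    · rw [Finset.prod_eq_zero (Finset.mem_univ j) (Nat.descFactorial_of_lt h1)]
      simp
    · have : borelMono (fun j => J j - I j) (0 : Fin m → ℝ) = 0 := by
        apply Finset.prod_eq_zero (Finset.mem_univ j)
        simp only [Pi.zero_apply]
        exact zero_pow (by omega)
      rw [this]
      simp

open Filter Topology in
/-- A single term of the Borel series. -/
theorem borel_term {m : ℕ} {F : Type} [NormedAddCommGroup F] [NormedSpace ℝ F]
    (J : Fin m → ℕ) (c : F) (ε : ℝ) (hε : 0 < ε) :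
    ∃ f : (Fin m → ℝ) → F, ContDiff ℝ (⊤ : ℕ∞) f ∧
      (f =ᶠ[𝓝 0] fun x => borelMono J x • c) ∧
      (∀ k : ℕ, ∃ C : ℝ, ∀ x, ‖iteratedFDeriv ℝ k f x‖ ≤ C) ∧
      (∀ k : ℕ, k < ∑ j, J j → ∀ x, ‖iteratedFDeriv ℝ k f x‖ ≤ ε) := by
  let χ : ContDiffBump (0 : Fin m → ℝ) := ⟨1, 2, one_pos, one_lt_two⟩
  set d := ∑ j, J j with hd
  let g : (Fin m → ℝ) → F := fun x => χ x • borelMono J x • c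
  have hg : ContDiff ℝ (⊤ : ℕ∞) g :=
    χ.contDiff.smul ((borelMono_contDiff J).smul contDiff_const)
  have hgs : HasCompactSupport g := χ.hasCompactSupport.smul_right
  have hb : ∀ k : ℕ, ∃ C : ℝ, ∀ x, ‖iteratedFDeriv ℝ k g x‖ ≤ C := fun k =>
    (hg.continuous_iteratedFDeriv (by exact_mod_cast le_top)).bounded_above_of_compact_support
      (hgs.iteratedFDeriv k)
  choose C hC using hb
  have hC0 : ∀ k, 0 ≤ C k := fun k => (norm_nonneg _).trans (hC k 0)
  let l : ℝ := 1 + ε⁻¹ * ∑ k ∈ Finset.range d, C k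
  have hs : 0 ≤ ∑ k ∈ Finset.range d, C k := Finset.sum_nonneg fun k _ => hC0 k
  have hl : 1 ≤ l := by
    have : 0 ≤ ε⁻¹ * ∑ k ∈ Finset.range d, C k := by positivity
    simp only [l]; linarith
  have hl0 : 0 < l := by linarith
  have hnorm : ∀ (k : ℕ) (x : Fin m → ℝ),
      ‖iteratedFDeriv ℝ k (fun x => (l ^ d)⁻¹ • g (l • x)) x‖ ≤ (l ^ d)⁻¹ * (l ^ k * C k) := by
    intro k x
    have hgk : ContDiff ℝ k g := hg.of_le (by exact_mod_cast le_top)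
    rw [iteratedFDeriv_const_smul_apply' (f := fun x => g (l • x))
        (hgk.comp (contDiff_const_smul l)).contDiffAt,
      iteratedFDeriv_comp_const_smul l hgk, norm_smul, norm_smul,
      Real.norm_of_nonneg (by positivity), Real.norm_of_nonneg (by positivity)]
    gcongr
    exact hC k _
  refine ⟨fun x => (l ^ d)⁻¹ • g (l • x), ?_, ?_, fun k => ⟨_, hnorm k⟩, ?_⟩
  · exact (hg.comp (contDiff_const_smul l)).const_smul _
  · have h1 : Tendsto (fun x : Fin m → ℝ => l • x) (𝓝 0) (𝓝 0) := by
      simpa using (continuous_const_smul l).tendsto (0 : Fin m → ℝ)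
    filter_upwards [h1.eventually χ.eventuallyEq_one] with x hx
    simp only [g, hx, borelMono_smul, ← hd, Pi.one_apply, one_mul, smul_smul]
    rw [inv_mul_cancel_left₀ (pow_pos hl0 d).ne']
  · intro k hk x
    refine (hnorm k x).trans ?_
    have h1 : C k ≤ ε * l := by
      have : C k ≤ ∑ k ∈ Finset.range d, C k :=
        Finset.single_le_sum (fun k _ => hC0 k) (Finset.mem_range.2 hk)
      simp only [l, mul_add, mul_inv_cancel_left₀ hε.ne']
      linarith
    have h2 : l ^ (k + 1) ≤ l ^ d := pow_le_pow_right₀ hl hk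
    rw [inv_mul_le_iff₀ (by positivity)]
    calc l ^ k * C k ≤ l ^ k * (ε * l) := by gcongr
      _ = l ^ (k + 1) * ε := by ring
      _ ≤ l ^ d * ε := by gcongr

/-- **Borel's theorem.** For every map `t : ℕ^m → ℝ^n` there is a smooth
function `ψ : ℝ^m → ℝ^n` whose Taylor coefficients at `0` are exactly the `t I`, i.e.
`∂^I ψ (0) = I! • t I` for every multi-index `I`. -/
theorem stmt17 (m n : ℕ) (t : (Fin m → ℕ) → (Fin n → ℝ)) :
    ∃ ψ : (Fin m → ℝ) → (Fin n → ℝ), ContDiff ℝ (⊤ : ℕ∞) ψ ∧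
      ∀ I : Fin m → ℕ,
        iterDeriv (multiIdxList m I) ψ 0 = ((∏ j, Nat.factorial (I j) : ℕ) : ℝ) • t I := by
  obtain ⟨ε, hε, c, hsum, -⟩ := posSumOfEncodable (one_pos : (0 : ℝ) < 1) (Fin m → ℕ)
  choose f hf hf0 hC hsmall using fun J => borel_term J (t J) (ε J) (hε J)
  choose C hC using hC
  let v : ℕ → (Fin m → ℕ) → ℝ := fun k J => if k < ∑ j, J j then ε J else C J k
  have hv : ∀ k : ℕ, (k : ℕ∞) ≤ ⊤ → Summable (v k) := by
    intro k _
    have hfin : {J : Fin m → ℕ | ¬ k < ∑ j, J j}.Finite := by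
      refine (Set.finite_Icc (0 : Fin m → ℕ) (fun _ => k)).subset fun J hJ => ⟨fun j => Nat.zero_le _, ?_⟩
      intro j
      exact (Finset.single_le_sum (fun _ _ => Nat.zero_le _) (Finset.mem_univ j)).trans
        (not_lt.1 hJ)
    refine (summable_congr_cofinite ?_).2 hsum.summable
    refine hfin.subset fun J hJ h => hJ ?_
    simp [v, h]
  have hb : ∀ (k : ℕ) (J : Fin m → ℕ) (x : Fin m → ℝ), (k : ℕ∞) ≤ ⊤ →
      ‖iteratedFDeriv ℝ k (f J) x‖ ≤ v k J := by
    intro k J x _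
    simp only [v]
    split_ifs with h
    · exact hsmall J k h x
    · exact hC J k x
  have hψ : ContDiff ℝ (⊤ : ℕ∞) (fun x => ∑' J, f J x) := contDiff_tsum hf hv hb
  refine ⟨fun x => ∑' J, f J x, hψ, fun I => ?_⟩
  set L := multiIdxList m I with hL
  rw [borel_iterDeriv_eq _ hψ, iteratedFDeriv_tsum_apply hf hv hb le_top]
  have hS : Summable fun J => iteratedFDeriv ℝ L.length (f J) 0 :=
    .of_norm_bounded (hv _ le_top) fun J => hb _ J 0 le_top
  rw [ContinuousMultilinearMap.tsum_eval hS]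
  have key : ∀ J, iteratedFDeriv ℝ L.length (f J) 0 (fun i => Pi.single (L.get i) 1) =
      if J = I then ((∏ j, Nat.factorial (I j) : ℕ) : ℝ) • t J else 0 := by
    intro J
    rw [← borelMono_coeff, ((hf0 J).iteratedFDeriv ℝ L.length).eq_of_nhds, ← hL,
      borel_iterDeriv_eq (fun x => borelMono J x • t J) ((borelMono_contDiff J).smul contDiff_const)]
  simp_rw [key]
  rw [tsum_ite_eq]
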